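/- Let 𝒬 be a UCQ, ℛ a finite set of disjunctive existential rules and F a fact base. Then chase(F, ℛ) ⊨ 𝒬 (i.e., every element of the chase result entails some CQ of 𝒬) if and only if there exists a FINITE derivation tree 𝒯 of (F, ℛ) such that res(𝒯) ⊨ 𝒬. -/

import Mathlib

/-! ## Basic syntax: terms, atoms, substitutions -/

/-- A term over variables `V` and constants `C`. -/
inductive FOTerm (V C : Type) where
  | var (v : V)
  | const (c : C)
deriving DecidableEq

/-- An atom `p(t_1,...,t_n)`. -/
structure FOAtom (P V C : Type) where
  pred : P
  args : List (FOTerm V C)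
deriving DecidableEq

/-- A substitution of variables by terms. -/
abbrev FOSubst (V C : Type) := V → FOTerm V C

variable {P V C : Type}

def FOTerm.applySub (u : FOSubst V C) : FOTerm V C → FOTerm V C
  | FOTerm.var v => u v
  | FOTerm.const c => FOTerm.const c

def FOAtom.applySub (u : FOSubst V C) (a : FOAtom P V C) : FOAtom P V C :=
  ⟨a.pred, a.args.map (FOTerm.applySub u)⟩

def applySubFS [DecidableEq P] [DecidableEq V] [DecidableEq C]
    (u : FOSubst V C) (S : Finset (FOAtom P V C)) : Finset (FOAtom P V C) :=
  S.image (FOAtom.applySub u)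

def FOTerm.varsOf [DecidableEq V] : FOTerm V C → Finset V
  | FOTerm.var v => {v}
  | FOTerm.const _ => ∅

def FOAtom.varsOf [DecidableEq V] (a : FOAtom P V C) : Finset V :=
  a.args.foldr (fun t acc => t.varsOf ∪ acc) ∅

/-- Variables occurring in a finite set of atoms. -/
def varsFS [DecidableEq V] (S : Finset (FOAtom P V C)) : Finset V :=
  S.sup FOAtom.varsOf

/-- Terms occurring in a finite set of atoms. -/
def termsFS [DecidableEq V] [DecidableEq C] (S : Finset (FOAtom P V C)) :
    Finset (FOTerm V C) :=
  S.sup (fun a => a.args.toFinset)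

/-- `h` is a homomorphism from the atom set `S₁` to the atom set `S₂`. -/
def IsHom (h : FOSubst V C) (S₁ S₂ : Finset (FOAtom P V C)) : Prop :=
  ∀ a ∈ S₁, a.applySub h ∈ S₂

/-- `S₂ ⊨ S₁` for atom sets viewed as existentially closed conjunctions:
there is a homomorphism from `S₁` to `S₂`. -/
def EntailsFS (S₂ S₁ : Finset (FOAtom P V C)) : Prop :=
  ∃ h : FOSubst V C, IsHom h S₁ S₂

/-! ## Disjunctive existential rules, triggers, chase step α -/

/-- A disjunctive existential rule `B → H₁ ∨ ... ∨ Hₙ`. -/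
structure DisjRule (P V C : Type) where
  body : Finset (FOAtom P V C)
  heads : List (Finset (FOAtom P V C))

/-- Well-formedness: non-empty body, at least one head disjunct, non-empty disjuncts. -/
def DisjRule.WF (R : DisjRule P V C) : Prop :=
  R.body.Nonempty ∧ R.heads ≠ [] ∧ ∀ H ∈ R.heads, H.Nonempty

/-- All variables of a rule. -/
def DisjRule.vars [DecidableEq V] (R : DisjRule P V C) : Finset V :=
  varsFS R.body ∪ R.heads.foldr (fun H acc => varsFS H ∪ acc) ∅

/-- A trigger `(R, h)` on `F`: `h` is a homomorphism from the body of `R` to `F`. -/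
def IsTrigger (R : DisjRule P V C) (h : FOSubst V C) (F : Finset (FOAtom P V C)) : Prop :=
  IsHom h R.body F

/-- `h'` is a safe extension of `h` for the head disjunct `H` of rule `R` w.r.t. the
fact base `F`: it agrees with `h` outside the existential variables of `H` and renames
the existential variables of `H` injectively to fresh variables. -/
def IsSafeExt [DecidableEq V] (F : Finset (FOAtom P V C)) (R : DisjRule P V C)
    (H : Finset (FOAtom P V C)) (h h' : FOSubst V C) : Prop :=
  (∀ v : V, v ∉ varsFS H \ varsFS R.body → h' v = h v) ∧
  (∀ v ∈ varsFS H \ varsFS R.body, ∃ w : V, h' v = FOTerm.var w ∧ w ∉ varsFS F) ∧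
  (∀ v ∈ varsFS H \ varsFS R.body, ∀ v' ∈ varsFS H \ varsFS R.body,
      h' v = h' v' → v = v')

/-- `L` is a result of the application `α_∨(F, R, h)` of the trigger `(R, h)` on `F`:
its `i`-th element is `F ∪ h^{safeᵢ}(Hᵢ)`. -/
def IsAlpha [DecidableEq P] [DecidableEq V] [DecidableEq C]
    (F : Finset (FOAtom P V C)) (R : DisjRule P V C) (h : FOSubst V C)
    (L : List (Finset (FOAtom P V C))) : Prop :=
  L.length = R.heads.length ∧
  ∀ (i : ℕ) (hi : i < L.length) (hi' : i < R.heads.length),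
    ∃ h' : FOSubst V C, IsSafeExt F R (R.heads.get ⟨i, hi'⟩) h h' ∧
      L.get ⟨i, hi⟩ = F ∪ applySubFS h' (R.heads.get ⟨i, hi'⟩)

/-! ## Partitions of terms (as equivalence relations), piece-unifiers -/

/-- A relation on terms, representing a partition of a set of terms (two terms are
related iff they belong to the same class). -/
abbrev TRel (V C : Type) := FOTerm V C → FOTerm V C → Prop

/-- Admissibility of a partition: no class contains two distinct constants. -/
def RelAdmissible (r : TRel V C) : Prop :=
  ∀ c c' : C, r (FOTerm.const c) (FOTerm.const c') → c = c'

/-- `u` is a substitution associated with the partition represented by `r`: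
it is constant on classes, maps each term to a member of its class (the selected term),
and gives priority to constants. -/
def IsAssocSub (r : TRel V C) (u : FOSubst V C) : Prop :=
  (∀ s t, r s t → s.applySub u = t.applySub u) ∧
  (∀ t, r t (t.applySub u)) ∧
  (∀ (v : V) (c : C), r (FOTerm.var v) (FOTerm.const c) → u v = FOTerm.const c)

/-- The data of a piece-unifier `(Q', H', P_u)`. -/
structure PieceUnif (P V C : Type) where
  Q' : Finset (FOAtom P V C)
  H' : Finset (FOAtom P V C)
  rel : TRel V C

/-- `μ` is a piece-unifier of the CQ `Q` with the conjunctive rule `B → H`. -/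
def IsPieceUnifier [DecidableEq P] [DecidableEq V] [DecidableEq C]
    (Q : Finset (FOAtom P V C)) (B H : Finset (FOAtom P V C))
    (μ : PieceUnif P V C) : Prop :=
  μ.Q'.Nonempty ∧ μ.Q' ⊆ Q ∧ μ.H' ⊆ H ∧
  Equivalence μ.rel ∧
  -- the partition is on the terms of Q' and H' (all other classes are singletons)
  (∀ s t, μ.rel s t → s = t ∨
      (s ∈ termsFS μ.Q' ∪ termsFS μ.H' ∧ t ∈ termsFS μ.Q' ∪ termsFS μ.H')) ∧
  RelAdmissible μ.rel ∧
  -- classes containing an existential variable of H' contain otherwise only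
  -- non-separating variables of Q'
  (∀ z ∈ varsFS μ.H' \ varsFS B, ∀ t, μ.rel (FOTerm.var z) t → t = FOTerm.var z ∨
      ∃ v : V, t = FOTerm.var v ∧ FOTerm.var v ∈ termsFS μ.Q' ∧ v ∉ varsFS (Q \ μ.Q')) ∧
  -- unification condition
  (∀ u : FOSubst V C, IsAssocSub μ.rel u → applySubFS u μ.Q' = applySubFS u μ.H')

/-- The join of a list of partitions (represented as relations): the equivalence
relation generated by their union. -/
def joinRel (rs : List (TRel V C)) : TRel V C :=
  Relation.EqvGen (fun s t => ∃ r ∈ rs, r s t)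

/-- The data of a disjunctive piece-unifier: the safe copies `Q₁, ..., Qₙ` together
with the conjunctive piece-unifiers `μ₁, ..., μₙ`. -/
structure DisjPieceUnif (P V C : Type) where
  Qs : List (Finset (FOAtom P V C))
  mus : List (PieceUnif P V C)

/-- The join of the partitions of a disjunctive piece-unifier. -/
def DisjPieceUnif.rel (μ : DisjPieceUnif P V C) : TRel V C :=
  joinRel (μ.mus.map PieceUnif.rel)

/-- `Qc` is a safe copy of `Q` (bijective renaming of its variables). -/
def IsSafeCopy [DecidableEq P] [DecidableEq V] [DecidableEq C]
    (Q Qc : Finset (FOAtom P V C)) : Prop :=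
  ∃ ρ : V → V, Function.Injective ρ ∧
    Qc = Q.image (FOAtom.applySub (fun v => FOTerm.var (ρ v)))

/-- `μ` is a disjunctive piece-unifier of the UCQ `𝒬` with the disjunctive rule `R`. -/
def IsDisjPieceUnifier [DecidableEq P] [DecidableEq V] [DecidableEq C]
    (𝒬 : Set (Finset (FOAtom P V C))) (R : DisjRule P V C)
    (μ : DisjPieceUnif P V C) : Prop :=
  μ.Qs.length = R.heads.length ∧ μ.mus.length = R.heads.length ∧
  -- each Qᵢ is a safe copy of a CQ of 𝒬, with variables disjoint from the rule
  -- and from the other copies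
  (∀ (i : ℕ) (hi : i < μ.Qs.length), ∃ Q ∈ 𝒬, IsSafeCopy Q (μ.Qs.get ⟨i, hi⟩)) ∧
  (∀ (i : ℕ) (hi : i < μ.Qs.length), Disjoint (varsFS (μ.Qs.get ⟨i, hi⟩)) R.vars) ∧
  (∀ (i j : ℕ) (hi : i < μ.Qs.length) (hj : j < μ.Qs.length), i ≠ j →
      Disjoint (varsFS (μ.Qs.get ⟨i, hi⟩)) (varsFS (μ.Qs.get ⟨j, hj⟩))) ∧
  -- each μᵢ is a piece-unifier of Qᵢ with B → Hᵢ
  (∀ (i : ℕ) (hi : i < R.heads.length) (hi1 : i < μ.Qs.length) (hi2 : i < μ.mus.length),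
      IsPieceUnifier (μ.Qs.get ⟨i, hi1⟩) R.body (R.heads.get ⟨i, hi⟩)
        (μ.mus.get ⟨i, hi2⟩)) ∧
  -- the join of the partitions is admissible
  RelAdmissible μ.rel

/-- `β_∨(𝒬, R, μ) = u(B) ∪ ⋃ᵢ u(Qᵢ ∖ Qᵢ')`, for `u` a substitution associated with
the join of the partitions of `μ`. -/
def betaRw [DecidableEq P] [DecidableEq V] [DecidableEq C]
    (R : DisjRule P V C) (μ : DisjPieceUnif P V C) (u : FOSubst V C) :
    Finset (FOAtom P V C) :=
  applySubFS u R.body ∪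
    (List.zipWith (fun Qi m => applySubFS u (Qi \ PieceUnif.Q' m)) μ.Qs μ.mus).foldr
      (· ∪ ·) ∅

/-! ## Semantics -/

/-- A first-order interpretation (with non-empty domain). -/
structure Interp (P V C : Type) where
  dom : Type
  nonempty : Nonempty dom
  rel : P → List dom → Prop
  cst : C → dom

def Interp.evalT (I : Interp P V C) (a : V → I.dom) : FOTerm V C → I.dom
  | FOTerm.var v => a v
  | FOTerm.const c => I.cst c

def Interp.satAtom (I : Interp P V C) (a : V → I.dom) (atm : FOAtom P V C) : Prop :=
  I.rel atm.pred (atm.args.map (I.evalT a))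

def Interp.satFS (I : Interp P V C) (a : V → I.dom) (S : Finset (FOAtom P V C)) : Prop :=
  ∀ atm ∈ S, I.satAtom a atm

/-- `I` is a model of the atom set `S` viewed as an existentially closed conjunction. -/
def Interp.modelsFB [DecidableEq V] (I : Interp P V C) (S : Finset (FOAtom P V C)) : Prop :=
  ∃ a : V → I.dom, I.satFS a S

/-- `I` satisfies the disjunctive existential rule `R`. -/
def Interp.satRule [DecidableEq V] (I : Interp P V C) (R : DisjRule P V C) : Prop :=
  ∀ a : V → I.dom, I.satFS a R.body →
    ∃ H ∈ R.heads, ∃ a' : V → I.dom,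
      (∀ v ∈ varsFS R.body, a' v = a v) ∧ I.satFS a' H

/-- First-order entailment `F, ℛ ⊨ 𝒬` of a UCQ from a fact base and a set of
disjunctive existential rules. -/
def SemEntails [DecidableEq V] (F : Finset (FOAtom P V C)) (ℛ : Set (DisjRule P V C))
    (𝒬 : Set (Finset (FOAtom P V C))) : Prop :=
  ∀ I : Interp P V C, I.modelsFB F → (∀ R ∈ ℛ, I.satRule R) →
    ∃ Q ∈ 𝒬, I.modelsFB Q

/-! ## Piece-rewriting -/

/-- `IsPieceRewriting ℛ 𝒬 𝒬'` holds when the UCQ `𝒬'` is obtained from the UCQ `𝒬`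
by a finite sequence of one-step piece-rewritings with rules of `ℛ`. -/
inductive IsPieceRewriting [DecidableEq P] [DecidableEq V] [DecidableEq C]
    (ℛ : Set (DisjRule P V C)) :
    Finset (Finset (FOAtom P V C)) → Finset (Finset (FOAtom P V C)) → Prop
  | refl (𝒬 : Finset (Finset (FOAtom P V C))) : IsPieceRewriting ℛ 𝒬 𝒬
  | step (𝒬 𝒬' : Finset (Finset (FOAtom P V C))) (R : DisjRule P V C)
      (μ : DisjPieceUnif P V C) (u : FOSubst V C) :
      IsPieceRewriting ℛ 𝒬 𝒬' → R ∈ ℛ →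
      IsDisjPieceUnifier (↑𝒬' : Set (Finset (FOAtom P V C))) R μ →
      IsAssocSub μ.rel u →
      IsPieceRewriting ℛ 𝒬 (insert (betaRw R μ u) 𝒬')

/-- A (possibly infinite) derivation tree of `(F₀, ℛ)`: a rooted labeled tree whose
root is labeled `F₀` and such that the labels of the children of any inner vertex are
exactly the result of applying a trigger of a rule of `ℛ` to the vertex's label. -/
structure DerivTree {P V C : Type} [DecidableEq P] [DecidableEq V] [DecidableEq C]
    (ℛ : Set (DisjRule P V C)) (F₀ : Finset (FOAtom P V C)) where
  Vtx : Type
  root : Vtx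
  label : Vtx → Finset (FOAtom P V C)
  children : Vtx → List Vtx
  root_label : label root = F₀
  step : ∀ v : Vtx, children v ≠ [] →
    ∃ R ∈ ℛ, ∃ h : FOSubst V C, IsTrigger R h (label v) ∧
      IsAlpha (label v) R h ((children v).map label)

/-- A branch of a derivation tree: a maximal path from the root (encoded as a
sequence of vertices which stutters once a leaf is reached). -/
def DerivTree.IsBranch {P V C : Type} [DecidableEq P] [DecidableEq V] [DecidableEq C]
    {ℛ : Set (DisjRule P V C)} {F₀ : Finset (FOAtom P V C)}
    (T : DerivTree ℛ F₀) (b : ℕ → T.Vtx) : Prop :=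
  b 0 = T.root ∧
  ∀ k : ℕ, b (k + 1) ∈ T.children (b k) ∨ (T.children (b k) = [] ∧ b (k + 1) = b k)

/-- A (possibly infinite) set of facts `S` entails the CQ `Q`. -/
def SetEntailsCQ {P V C : Type} (S : Set (FOAtom P V C)) (Q : Finset (FOAtom P V C)) :
    Prop :=
  ∃ h : FOSubst V C, ∀ a ∈ Q, a.applySub h ∈ S

/-- `res(𝒯) ⊨ 𝒬`: every element of the result of the derivation tree `𝒯` (the union
of the labels along a branch, for each branch) entails some CQ of `𝒬`. -/
def DerivTree.ResEntails {P V C : Type} [DecidableEq P] [DecidableEq V] [DecidableEq C]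
    {ℛ : Set (DisjRule P V C)} {F₀ : Finset (FOAtom P V C)}
    (T : DerivTree ℛ F₀) (𝒬 : Set (Finset (FOAtom P V C))) : Prop :=
  ∀ b : ℕ → T.Vtx, T.IsBranch b →
    ∃ Q ∈ 𝒬, SetEntailsCQ (⋃ k : ℕ, (↑(T.label (b k)) : Set (FOAtom P V C))) Q

/-- The trigger `(R, h)` is satisfied by `F`: some extension of `h` maps some head
disjunct of `R` into `F`. -/
def TriggerSatisfied {P V C : Type} [DecidableEq V]
    (R : DisjRule P V C) (h : FOSubst V C) (F : Finset (FOAtom P V C)) : Prop :=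
  ∃ H ∈ R.heads, ∃ h' : FOSubst V C,
    (∀ v ∈ varsFS R.body, h' v = h v) ∧ IsHom h' H F

/-- Fairness: along every branch, every trigger on a vertex label is satisfied at
some vertex of the branch. A chase tree is a fair derivation tree. -/
def DerivTree.Fair {P V C : Type} [DecidableEq P] [DecidableEq V] [DecidableEq C]
    {ℛ : Set (DisjRule P V C)} {F₀ : Finset (FOAtom P V C)}
    (T : DerivTree ℛ F₀) : Prop :=
  ∀ b : ℕ → T.Vtx, T.IsBranch b → ∀ k : ℕ, ∀ R ∈ ℛ, ∀ h : FOSubst V C,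
    IsTrigger R h (T.label (b k)) →
      ∃ k' : ℕ, TriggerSatisfied R h (T.label (b k'))

/-! ## Substitutions, variables and homomorphisms -/

/-- The composition of substitutions: apply `u` first, then `s`. -/
def FOSubst.comp (s u : FOSubst V C) : FOSubst V C := fun v => (u v).applySub s

theorem FOTerm.applySub_comp (s u : FOSubst V C) (t : FOTerm V C) :
    t.applySub (s.comp u) = (t.applySub u).applySub s := by
  cases t <;> rfl

theorem FOAtom.applySub_comp (s u : FOSubst V C) (a : FOAtom P V C) :
    a.applySub (s.comp u) = (a.applySub u).applySub s := by
  simp [FOAtom.applySub, FOTerm.applySub_comp]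

theorem FOAtom.mem_varsOf [DecidableEq V] {a : FOAtom P V C} {v : V} :
    v ∈ a.varsOf ↔ FOTerm.var v ∈ a.args := by
  obtain ⟨p, l⟩ := a
  simp only [FOAtom.varsOf]
  induction l with
  | nil => simp
  | cons t l ih =>
    rw [List.foldr_cons, Finset.mem_union, ih]
    cases t <;> simp [FOTerm.varsOf]

theorem mem_varsFS [DecidableEq V] {S : Finset (FOAtom P V C)} {v : V} :
    v ∈ varsFS S ↔ ∃ a ∈ S, FOTerm.var v ∈ a.args := by
  simp [varsFS, Finset.mem_sup, FOAtom.mem_varsOf]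

theorem FOAtom.applySub_congr {s u : FOSubst V C} {a : FOAtom P V C}
    (h : ∀ v, FOTerm.var v ∈ a.args → s v = u v) : a.applySub s = a.applySub u := by
  simp only [FOAtom.applySub, FOAtom.mk.injEq, true_and]
  refine List.map_congr_left fun t ht => ?_
  cases t with
  | var v => exact h v ht
  | const c => rfl

/-- A variable that is the image of a variable of the source occurs in the target. -/
theorem IsHom.mem_varsFS_of_eq_var [DecidableEq V] {h : FOSubst V C}
    {S₁ S₂ : Finset (FOAtom P V C)} (hh : IsHom h S₁ S₂) {v w : V} (hv : v ∈ varsFS S₁)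
    (hw : h v = FOTerm.var w) : w ∈ varsFS S₂ := by
  obtain ⟨a, ha, hva⟩ := mem_varsFS.1 hv
  refine mem_varsFS.2 ⟨_, hh a ha, ?_⟩
  rw [← hw]
  exact List.mem_map_of_mem (f := FOTerm.applySub h) hva

/-- A homomorphism into the union of a monotone sequence of fact bases is a homomorphism
into some member of the sequence. -/
theorem exists_isHom_of_monotone {L : ℕ → Finset (FOAtom P V C)} (hL : Monotone L)
    {h : FOSubst V C} {Q : Finset (FOAtom P V C)}
    (hQ : ∀ a ∈ Q, a.applySub h ∈ ⋃ k, (↑(L k) : Set (FOAtom P V C))) :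
    ∃ k, IsHom h Q (L k) := by
  simp only [Set.mem_iUnion, Finset.mem_coe] at hQ
  choose! f hf using hQ
  exact ⟨Q.sup f, fun a ha => hL (Finset.le_sup ha) (hf a ha)⟩

/-- Dependent choice along an invariant. -/
theorem exists_seq_of_invariant {α : Type*} {r : α → α → Prop} {p : α → Prop} {a : α}
    (ha : p a) (hstep : ∀ x, p x → ∃ y, r x y ∧ p y) :
    ∃ b : ℕ → α, b 0 = a ∧ ∀ k, r (b k) (b (k + 1)) ∧ p (b k) := by
  choose! f hf using hstep
  have hp : ∀ k, p (f^[k] a) := by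
    intro k
    induction k with
    | zero => exact ha
    | succ k ih =>
      rw [Function.iterate_succ_apply']
      exact (hf _ ih).2
  refine ⟨fun k => f^[k] a, rfl, fun k => ⟨?_, hp k⟩⟩
  simp only [Function.iterate_succ_apply']
  exact (hf _ (hp k)).1

/-- A homomorphism `g` from a fact base to `S` extends over a safe head instance as soon as
some extension of the composed trigger maps the head disjunct into `S`. -/
theorem exists_hom_union_of_isSafeExt [DecidableEq P] [DecidableEq V] [DecidableEq C]
    {F H : Finset (FOAtom P V C)} {R : DisjRule P V C} {h h' g e : FOSubst V C}
    {S : Set (FOAtom P V C)} (htr : IsTrigger R h F) (hsafe : IsSafeExt F R H h h')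
    (hg : ∀ a ∈ F, a.applySub g ∈ S) (he : ∀ v ∈ varsFS R.body, e v = g.comp h v)
    (heH : ∀ a ∈ H, a.applySub e ∈ S) :
    ∃ g' : FOSubst V C, ∀ a ∈ F ∪ applySubFS h' H, a.applySub g' ∈ S := by
  classical
  obtain ⟨hsame, hfresh, hinj⟩ := hsafe
  let isNew : V → V → Prop := fun w z => z ∈ varsFS H \ varsFS R.body ∧ h' z = FOTerm.var w
  let g' : FOSubst V C := fun w => if hw : ∃ z, isNew w z then e hw.choose else g w
  have hold : ∀ w ∈ varsFS F, g' w = g w := by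
    intro w hwF
    refine dif_neg ?_
    rintro ⟨z, hz, hzw⟩
    obtain ⟨w', hw', hnot⟩ := hfresh z hz
    rw [hzw] at hw'
    cases hw'
    exact hnot hwF
  have hnew : ∀ w z, isNew w z → g' w = e z := by
    intro w z hz
    have hex : ∃ z, isNew w z := ⟨z, hz⟩
    have hc := hex.choose_spec
    have : hex.choose = z := hinj _ hc.1 _ hz.1 (hc.2.trans hz.2.symm)
    change (if hw : ∃ z, isNew w z then e hw.choose else g w) = _
    rw [dif_pos hex, this]
  refine ⟨g', fun a ha => ?_⟩
  rcases Finset.mem_union.1 ha with ha | ha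
  · rw [FOAtom.applySub_congr (u := g) fun v hv => hold v (mem_varsFS.2 ⟨a, ha, hv⟩)]
    exact hg a ha
  · obtain ⟨c, hc, rfl⟩ := Finset.mem_image.1 ha
    rw [← FOAtom.applySub_comp, FOAtom.applySub_congr (u := e)]
    · exact heH c hc
    intro v hv
    have hvH : v ∈ varsFS H := mem_varsFS.2 ⟨c, hc, hv⟩
    by_cases hvB : v ∈ varsFS R.body
    · rw [he v hvB]
      have hv' : h' v = h v := hsame v fun hmem => (Finset.mem_sdiff.1 hmem).2 hvB
      simp only [FOSubst.comp, hv']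
      cases hhv : h v with
      | var w => exact hold w (htr.mem_varsFS_of_eq_var hvB hhv)
      | const c => rfl
    · have hvE : v ∈ varsFS H \ varsFS R.body := Finset.mem_sdiff.2 ⟨hvH, hvB⟩
      obtain ⟨w, hw, -⟩ := hfresh v hvE
      simp only [FOSubst.comp, hw]
      exact hnew w v ⟨hvE, hw⟩

/-! ## Derivation trees -/

namespace DerivTree

variable [DecidableEq P] [DecidableEq V] [DecidableEq C] {ℛ : Set (DisjRule P V C)}
  {F : Finset (FOAtom P V C)}

/-- One step along a branch: go to a child, or stay at a leaf. -/
def Succ (T : DerivTree ℛ F) (v w : T.Vtx) : Prop :=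
  w ∈ T.children v ∨ (T.children v = [] ∧ w = v)

theorem label_subset_of_mem_children (T : DerivTree ℛ F) {v w : T.Vtx}
    (hw : w ∈ T.children v) : T.label v ⊆ T.label w := by
  obtain ⟨R, -, h, -, hlen, hα⟩ := T.step v (List.ne_nil_of_mem hw)
  obtain ⟨i, hi, rfl⟩ := List.getElem_of_mem hw
  have hi₁ : i < ((T.children v).map T.label).length := by simpa using hi
  obtain ⟨h', -, hlab⟩ := hα i hi₁ (hlen ▸ hi₁)
  simp only [List.get_eq_getElem, List.getElem_map] at hlab
  rw [hlab]
  exact Finset.subset_union_left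

theorem Succ.label_subset {T : DerivTree ℛ F} {v w : T.Vtx} (h : T.Succ v w) :
    T.label v ⊆ T.label w := by
  rcases h with h | ⟨-, rfl⟩
  · exact T.label_subset_of_mem_children h
  · exact subset_rfl

theorem IsBranch.monotone_label {T : DerivTree ℛ F} {b : ℕ → T.Vtx} (hb : T.IsBranch b) :
    Monotone fun k => T.label (b k) :=
  monotone_nat_of_le_succ fun k => Succ.label_subset (hb.2 k)

/-- The label of `v` entails some CQ of `𝒬`. -/
def EntailsAt (T : DerivTree ℛ F) (𝒬 : Set (Finset (FOAtom P V C))) (v : T.Vtx) : Prop :=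
  ∃ Q ∈ 𝒬, EntailsFS (T.label v) Q

theorem Succ.entailsAt {T : DerivTree ℛ F} {𝒬 : Set (Finset (FOAtom P V C))} {v w : T.Vtx}
    (h : T.Succ v w) (hv : T.EntailsAt 𝒬 v) : T.EntailsAt 𝒬 w := by
  obtain ⟨Q, hQ, g, hg⟩ := hv
  exact ⟨Q, hQ, g, fun a ha => h.label_subset (hg a ha)⟩

/-- The result of a tree entails a UCQ iff every branch has a vertex that entails it. -/
theorem resEntails_iff (T : DerivTree ℛ F) (𝒬 : Set (Finset (FOAtom P V C))) :
    T.ResEntails 𝒬 ↔ ∀ b, T.IsBranch b → ∃ k, T.EntailsAt 𝒬 (b k) := by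
  refine forall₂_congr fun b hb => ⟨?_, ?_⟩
  · rintro ⟨Q, hQ, h, hh⟩
    obtain ⟨k, hk⟩ := exists_isHom_of_monotone hb.monotone_label hh
    exact ⟨k, Q, hQ, h, hk⟩
  · rintro ⟨k, Q, hQ, h, hh⟩
    exact ⟨Q, hQ, h, fun a ha => Set.mem_iUnion.2 ⟨k, hh a ha⟩⟩

/-- A homomorphism from the label of a vertex to the union of a fair branch extends to some
successor of the vertex. -/
theorem exists_succ_hom {T T' : DerivTree ℛ F} (hfair : T.Fair) {b : ℕ → T.Vtx}
    (hb : T.IsBranch b) {v : T'.Vtx} {g : FOSubst V C}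
    (hg : ∀ a ∈ T'.label v, a.applySub g ∈ ⋃ k, (↑(T.label (b k)) : Set (FOAtom P V C))) :
    ∃ w, T'.Succ v w ∧ ∃ g' : FOSubst V C,
      ∀ a ∈ T'.label w, a.applySub g' ∈ ⋃ k, (↑(T.label (b k)) : Set (FOAtom P V C)) := by
  by_cases hv : T'.children v = []
  · exact ⟨v, Or.inr ⟨hv, rfl⟩, g, hg⟩
  obtain ⟨R, hR, h, htr, hlen, hα⟩ := T'.step v hv
  obtain ⟨k, hk⟩ := exists_isHom_of_monotone (h := g.comp h) (Q := R.body) hb.monotone_label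
    fun a ha => by
      rw [FOAtom.applySub_comp]
      exact hg _ (htr a ha)
  obtain ⟨k', H, hH, e, he, heH⟩ := hfair b hb k R hR _ hk
  obtain ⟨i, hi, rfl⟩ := List.getElem_of_mem hH
  obtain ⟨h', hsafe, hlab⟩ := hα i (hlen ▸ hi) hi
  have hi' : i < (T'.children v).length := by
    rw [← hlen] at hi
    simpa using hi
  simp only [List.get_eq_getElem, List.getElem_map] at hlab hsafe
  refine ⟨(T'.children v)[i], Or.inl (List.getElem_mem hi'), ?_⟩
  rw [hlab]
  exact exists_hom_union_of_isSafeExt htr hsafe hg he fun a ha =>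
    Set.mem_iUnion.2 ⟨k', heH a ha⟩

/-- A UCQ entailed by the result of some derivation tree is entailed by every fair one. -/
theorem Fair.resEntails {T T' : DerivTree ℛ F} (hfair : T.Fair)
    {𝒬 : Set (Finset (FOAtom P V C))} (h : T'.ResEntails 𝒬) : T.ResEntails 𝒬 := by
  intro b hb
  obtain ⟨b', hb'0, hb'⟩ := exists_seq_of_invariant (r := T'.Succ) (a := T'.root)
    (p := fun v => ∃ g : FOSubst V C,
      ∀ a ∈ T'.label v, a.applySub g ∈ ⋃ k, (↑(T.label (b k)) : Set (FOAtom P V C)))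
    ⟨FOTerm.var, fun a ha => by
      have hid : a.applySub FOTerm.var = a := by
        have : FOTerm.applySub (FOTerm.var : FOSubst V C) = id := by
          funext t
          cases t <;> rfl
        simp [FOAtom.applySub, this]
      rw [hid]
      refine Set.mem_iUnion.2 ⟨0, ?_⟩
      rw [hb.1, T.root_label, ← T'.root_label]
      exact ha⟩
    fun v ⟨_, hg⟩ => exists_succ_hom hfair hb hg
  obtain ⟨k, Q, hQ, q, hq⟩ :=
    (T'.resEntails_iff 𝒬).1 h b' ⟨hb'0, fun k => (hb' k).1⟩
  obtain ⟨g, hg⟩ := (hb' k).2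
  refine ⟨Q, hQ, g.comp q, fun a ha => ?_⟩
  rw [FOAtom.applySub_comp]
  exact hg _ (hq a ha)

/-! ### Truncation of a derivation tree -/

/-- All vertices reached from a vertex after `n` branch steps entail `𝒬`. -/
def EntailsWithin (T : DerivTree ℛ F) (𝒬 : Set (Finset (FOAtom P V C))) :
    ℕ → T.Vtx → Prop
  | 0, v => T.EntailsAt 𝒬 v
  | n + 1, v => ∀ w, T.Succ v w → T.EntailsWithin 𝒬 n w

theorem monotone_entailsWithin (T : DerivTree ℛ F) (𝒬 : Set (Finset (FOAtom P V C))) :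
    Monotone (T.EntailsWithin 𝒬) := by
  refine monotone_nat_of_le_succ fun n => ?_
  induction n with
  | zero => exact fun v hv w hw => hw.entailsAt hv
  | succ n ih => exact fun v hv w hw => ih w (hv w hw)

theorem EntailsWithin.entailsAt_of_leaf {T : DerivTree ℛ F}
    {𝒬 : Set (Finset (FOAtom P V C))} {n : ℕ} {v : T.Vtx} (h : T.EntailsWithin 𝒬 n v)
    (hv : T.children v = []) : T.EntailsAt 𝒬 v := by
  induction n with
  | zero => exact h
  | succ n ih => exact ih (h v (Or.inr ⟨hv, rfl⟩))

theorem finite_setOf_succ (T : DerivTree ℛ F) (v : T.Vtx) : {w | T.Succ v w}.Finite :=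
  ((T.children v).finite_toSet.union (Set.finite_singleton v)).subset fun _ hw =>
    hw.imp id And.right

theorem exists_entailsWithin_of_succ {T : DerivTree ℛ F} {𝒬 : Set (Finset (FOAtom P V C))}
    {v : T.Vtx} (h : ∀ w, T.Succ v w → ∃ n, T.EntailsWithin 𝒬 n w) :
    ∃ n, T.EntailsWithin 𝒬 n v := by
  choose! f hf using h
  obtain ⟨N, hN⟩ := ((T.finite_setOf_succ v).image f).bddAbove
  exact ⟨N + 1, fun w hw =>
    T.monotone_entailsWithin 𝒬 (hN (Set.mem_image_of_mem f hw)) w (hf w hw)⟩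

/-- König's lemma: if all branches entail `𝒬`, they do so within a uniform depth. -/
theorem ResEntails.exists_entailsWithin {T : DerivTree ℛ F}
    {𝒬 : Set (Finset (FOAtom P V C))} (h : T.ResEntails 𝒬) :
    ∃ n, T.EntailsWithin 𝒬 n T.root := by
  by_contra hroot
  obtain ⟨b, hb0, hb⟩ := exists_seq_of_invariant (r := T.Succ) (a := T.root)
    (p := fun v => ¬ ∃ n, T.EntailsWithin 𝒬 n v) hroot fun v hv => by
      by_contra hcon
      refine hv (exists_entailsWithin_of_succ fun w hw => ?_)
      by_contra hbad
      exact hcon ⟨w, hw, hbad⟩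
  obtain ⟨k, hk⟩ := (T.resEntails_iff 𝒬).1 h b ⟨hb0, fun k => (hb k).1⟩
  exact (hb k).2 ⟨0, hk⟩

/-- Children in the unfolding of `T` with a bounded remaining depth. -/
def boundedChildren (T : DerivTree ℛ F) : ℕ × T.Vtx → List (ℕ × T.Vtx)
  | (0, _) => []
  | (n + 1, v) => (T.children v).map (Prod.mk n)

/-- Reachability in the unfolding of `T` with a bounded remaining depth. -/
def BoundedReach (T : DerivTree ℛ F) : ℕ × T.Vtx → ℕ × T.Vtx → Prop :=
  Relation.ReflTransGen fun x y => y ∈ T.boundedChildren x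

theorem finite_setOf_boundedReach (T : DerivTree ℛ F) (n : ℕ) (v : T.Vtx) :
    {y | T.BoundedReach (n, v) y}.Finite := by
  induction n generalizing v with
  | zero =>
    refine (Set.finite_singleton ((0, v) : ℕ × T.Vtx)).subset fun y hy => ?_
    rcases Relation.ReflTransGen.cases_head hy with h | ⟨z, hz, -⟩
    · exact h.symm
    · simp [boundedChildren] at hz
  | succ n ih =>
    refine ((Set.finite_singleton ((n + 1, v) : ℕ × T.Vtx)).union
      ((T.children v).finite_toSet.biUnion fun w _ => ih w)).subset fun y hy => ?_
    rcases Relation.ReflTransGen.cases_head hy with h | ⟨z, hz, hzy⟩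
    · exact Or.inl h.symm
    · obtain ⟨w, hw, rfl⟩ := List.mem_map.1 hz
      exact Or.inr (Set.mem_biUnion (show w ∈ {w | w ∈ T.children v} from hw) hzy)

/-- The tree `T` cut at depth `n`. -/
def truncate (T : DerivTree ℛ F) (n : ℕ) : DerivTree ℛ F where
  Vtx := {x : ℕ × T.Vtx // T.BoundedReach (n, T.root) x}
  root := ⟨(n, T.root), Relation.ReflTransGen.refl⟩
  label x := T.label x.1.2
  children x := (T.boundedChildren x.1).pmap Subtype.mk
    fun _ hy => Relation.ReflTransGen.tail x.2 hy
  root_label := T.root_label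
  step := by
    rintro ⟨⟨m, v⟩, hx⟩ hne
    cases m with
    | zero => exact absurd rfl hne
    | succ m =>
      have hv : T.children v ≠ [] := by
        intro hv
        simp [boundedChildren, hv] at hne
      simpa [List.map_pmap, boundedChildren, Function.comp_def] using T.step v hv

theorem mem_children_truncate {T : DerivTree ℛ F} {n : ℕ} {x y : (T.truncate n).Vtx} :
    y ∈ (T.truncate n).children x ↔ y.1 ∈ T.boundedChildren x.1 := by
  refine List.mem_pmap.trans ⟨?_, fun h => ⟨y.1, h, rfl⟩⟩
  rintro ⟨a, ha, rfl⟩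
  exact ha

theorem finite_truncate_vtx (T : DerivTree ℛ F) (n : ℕ) : Finite (T.truncate n).Vtx :=
  (T.finite_setOf_boundedReach n T.root).to_subtype

theorem EntailsWithin.resEntails_truncate {T : DerivTree ℛ F}
    {𝒬 : Set (Finset (FOAtom P V C))} {n : ℕ} (h : T.EntailsWithin 𝒬 n T.root) :
    (T.truncate n).ResEntails 𝒬 := by
  refine ((T.truncate n).resEntails_iff 𝒬).2 fun b hb => ?_
  have key : ∀ m j, (b j).1.1 = m → T.EntailsWithin 𝒬 m (b j).1.2 →
      ∃ k, T.EntailsAt 𝒬 (b k).1.2 := by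
    intro m
    induction m with
    | zero => exact fun j _ hj => ⟨j, hj⟩
    | succ m ih =>
      intro j hm hj
      by_cases hleaf : T.children (b j).1.2 = []
      · exact ⟨j, hj.entailsAt_of_leaf hleaf⟩
      have hchild : T.boundedChildren (b j).1 =
          (T.children (b j).1.2).map (Prod.mk m) := by
        rw [← Prod.mk.eta (p := (b j).1), hm]
        rfl
      rcases hb.2 j with hnext | ⟨hnil, -⟩
      · rw [mem_children_truncate, hchild] at hnext
        obtain ⟨w, hw, hwe⟩ := List.mem_map.1 hnext
        refine ih (j + 1) (by rw [← hwe]) ?_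
        rw [← hwe]
        exact hj w (Or.inl hw)
      · have hnil' : T.boundedChildren (b j).1 = [] := List.pmap_eq_nil_iff.1 hnil
        rw [hchild, List.map_eq_nil_iff] at hnil'
        exact absurd hnil' hleaf
  refine key n 0 ?_ ?_
  · rw [hb.1]
    rfl
  · rw [hb.1]
    exact h

end DerivTree

/-- `chase(F, ℛ) ⊨ 𝒬` (for a chase tree, i.e., a fair derivation tree)
iff there exists a finite derivation tree `𝒯` of `(F, ℛ)` with `res(𝒯) ⊨ 𝒬`. -/
theorem stmt12 {P V C : Type} [DecidableEq P] [DecidableEq V] [DecidableEq C] [Infinite V]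
    (ℛ : Set (DisjRule P V C)) (hfin : ℛ.Finite) (hWF : ∀ R ∈ ℛ, R.WF)
    (F : Finset (FOAtom P V C)) (𝒬 : Finset (Finset (FOAtom P V C)))
    (T : DerivTree ℛ F) (hfair : T.Fair) :
    T.ResEntails (↑𝒬 : Set (Finset (FOAtom P V C))) ↔
      ∃ T' : DerivTree ℛ F, Finite T'.Vtx ∧
        T'.ResEntails (↑𝒬 : Set (Finset (FOAtom P V C))) := by
  constructor
  · intro h
    obtain ⟨n, hn⟩ := h.exists_entailsWithin
    exact ⟨T.truncate n, T.finite_truncate_vtx n, hn.resEntails_truncate⟩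
  · rintro ⟨T', -, h⟩
    exact hfair.resEntails h
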